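/- Suppose p satisfies Z ⊥ C | A and Y ⊥ A | (Z,C), and let θ'' and φ_bdfdtd be as defined in the context. Then Var_p(φ_bdfdtd) = Σ_z (p(z|a⋆) − p(z|a°))²·Σ_c p(c)·var(Y|z,c)/(Σ_ā p(ā|c)·p(z|ā)) + Σ_z p(z|a⋆)·(Σ_c p(c)·E(Y|z,c))²/p(a⋆) − (Σ_{z,c} E(Y|z,c)·p(z|a⋆)·p(c))²/p(a⋆) + Σ_z p(z|a°)·(Σ_c p(c)·E(Y|z,c))²/p(a°) − (Σ_{z,c} E(Y|z,c)·p(z|a°)·p(c))²/p(a°) + Σ_c p(c)·(Σ_z E(Y|z,c)·(p(z|a⋆) − p(z|a°)))² − θ''². -/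

import Mathlib

open Finset

noncomputable section

namespace TwoDoorPaper

/-- Indicator 1[a = b] as a real number. -/
def ind {A : Type*} [DecidableEq A] (a b : A) : ℝ := if a = b then 1 else 0

variable {C A Z Y : Type*} [Fintype C] [Fintype A] [Fintype Z] [Fintype Y]

/-- Marginal p(c). -/
def pC (p : C → A → Z → Y → ℝ) (c : C) : ℝ := ∑ a, ∑ z, ∑ y, p c a z y

/-- Marginal p(a,c). -/
def pAC (p : C → A → Z → Y → ℝ) (a : A) (c : C) : ℝ := ∑ z, ∑ y, p c a z y

/-- Marginal p(c,a,z). -/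
def pCAZ (p : C → A → Z → Y → ℝ) (c : C) (a : A) (z : Z) : ℝ := ∑ y, p c a z y

/-- Marginal p(a). -/
def pA (p : C → A → Z → Y → ℝ) (a : A) : ℝ := ∑ c, pAC p a c

/-- Marginal p(a,z). -/
def pAZ (p : C → A → Z → Y → ℝ) (a : A) (z : Z) : ℝ := ∑ c, pCAZ p c a z

/-- Marginal p(z,c). -/
def pZC (p : C → A → Z → Y → ℝ) (z : Z) (c : C) : ℝ := ∑ a, pCAZ p c a z

/-- Conditional p(a|c). -/
def cA (p : C → A → Z → Y → ℝ) (a : A) (c : C) : ℝ := pAC p a c / pC p c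

/-- Conditional p(z|a,c). -/
def cZ (p : C → A → Z → Y → ℝ) (z : Z) (a : A) (c : C) : ℝ := pCAZ p c a z / pAC p a c

/-- Conditional p(z|a). -/
def cZA (p : C → A → Z → Y → ℝ) (z : Z) (a : A) : ℝ := pAZ p a z / pA p a

/-- Conditional p(y|a,z,c). -/
def cY (p : C → A → Z → Y → ℝ) (a : A) (z : Z) (c : C) (y : Y) : ℝ := p c a z y / pCAZ p c a z

/-- Conditional p(y|a,z). -/
def cYaz (p : C → A → Z → Y → ℝ) (a : A) (z : Z) (y : Y) : ℝ := (∑ c, p c a z y) / pAZ p a z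

/-- Conditional p(y|a,c). -/
def cYac (p : C → A → Z → Y → ℝ) (a : A) (c : C) (y : Y) : ℝ := (∑ z, p c a z y) / pAC p a c

/-- Conditional p(y|z,c). -/
def cYzc (p : C → A → Z → Y → ℝ) (z : Z) (c : C) (y : Y) : ℝ := (∑ a, p c a z y) / pZC p z c

/-- Conditional expectation E(Y|a,z,c). -/
def EYazc (p : C → A → Z → Y → ℝ) (yv : Y → ℝ) (a : A) (z : Z) (c : C) : ℝ :=
  ∑ y, yv y * cY p a z c y

/-- Conditional variance var(Y|a,z,c). -/
def VYazc (p : C → A → Z → Y → ℝ) (yv : Y → ℝ) (a : A) (z : Z) (c : C) : ℝ :=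
  (∑ y, (yv y) ^ 2 * cY p a z c y) - (EYazc p yv a z c) ^ 2

/-- Conditional expectation E(Y|a,z). -/
def EYaz (p : C → A → Z → Y → ℝ) (yv : Y → ℝ) (a : A) (z : Z) : ℝ :=
  ∑ y, yv y * cYaz p a z y

/-- Conditional variance var(Y|a,z). -/
def VYaz (p : C → A → Z → Y → ℝ) (yv : Y → ℝ) (a : A) (z : Z) : ℝ :=
  (∑ y, (yv y) ^ 2 * cYaz p a z y) - (EYaz p yv a z) ^ 2

/-- Conditional expectation E(Y|a,c). -/
def EYac (p : C → A → Z → Y → ℝ) (yv : Y → ℝ) (a : A) (c : C) : ℝ :=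
  ∑ y, yv y * cYac p a c y

/-- Conditional expectation E(Y|z,c). -/
def EYzc (p : C → A → Z → Y → ℝ) (yv : Y → ℝ) (z : Z) (c : C) : ℝ :=
  ∑ y, yv y * cYzc p z c y

/-- Conditional variance var(Y|z,c). -/
def VYzc (p : C → A → Z → Y → ℝ) (yv : Y → ℝ) (z : Z) (c : C) : ℝ :=
  (∑ y, (yv y) ^ 2 * cYzc p z c y) - (EYzc p yv z c) ^ 2

/-- var(C|a) for real-valued covariates. -/
def VCgivenA (p : C → A → Z → Y → ℝ) (cv : C → ℝ) (a : A) : ℝ :=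
  (∑ c, (cv c) ^ 2 * (pAC p a c / pA p a)) - (∑ c, cv c * (pAC p a c / pA p a)) ^ 2

/-- var(Z|a) for real-valued mediators. -/
def VZgivenA (p : C → A → Z → Y → ℝ) (zv : Z → ℝ) (a : A) : ℝ :=
  (∑ z, (zv z) ^ 2 * cZA p z a) - (∑ z, zv z * cZA p z a) ^ 2

/-- Expectation of f under p. -/
def Ep (p : C → A → Z → Y → ℝ) (f : C → A → Z → Y → ℝ) : ℝ :=
  ∑ c, ∑ a, ∑ z, ∑ y, p c a z y * f c a z y

/-- Variance of f under p. -/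
def Varp (p : C → A → Z → Y → ℝ) (f : C → A → Z → Y → ℝ) : ℝ :=
  (∑ c, ∑ a, ∑ z, ∑ y, p c a z y * (f c a z y) ^ 2) - (Ep p f) ^ 2

/-- p is a strictly positive probability mass function. -/
def IsPMF (p : C → A → Z → Y → ℝ) : Prop :=
  (∀ c a z y, 0 < p c a z y) ∧ (∑ c, ∑ a, ∑ z, ∑ y, p c a z y) = 1

/-- Y ⊥ A | (Z, C): p(y|a,z,c) does not depend on a. -/
def IndepYA (p : C → A → Z → Y → ℝ) : Prop :=
  ∀ a a' z c y, cY p a z c y = cY p a' z c y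

/-- Z ⊥ C | A: p(z|a,c) = p(z|a) for all c. -/
def IndepZC (p : C → A → Z → Y → ℝ) : Prop :=
  ∀ z a c, cZ p z a c = cZA p z a

/-- θ_td. -/
def thTD (p : C → A → Z → Y → ℝ) (yv : Y → ℝ) (astar acirc : A) : ℝ :=
  ∑ z, ∑ c, ∑ ab, EYazc p yv ab z c * (cZ p z astar c - cZ p z acirc c) * cA p ab c * pC p c

/-- The two-door efficient influence function φ_td. -/
def phiTD [DecidableEq A] (p : C → A → Z → Y → ℝ) (yv : Y → ℝ) (astar acirc : A)
    (c : C) (a : A) (z : Z) (y : Y) : ℝ :=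
  (yv y - EYazc p yv a z c) * (cZ p z astar c - cZ p z acirc c) / cZ p z a c
  + ((∑ ab, EYazc p yv ab z c * cA p ab c)
      - ∑ ab, ∑ z', EYazc p yv ab z' c * cZ p z' a c * cA p ab c)
    * (ind a astar - ind a acirc) / cA p a c
  + (∑ z', EYazc p yv a z' c * (cZ p z' astar c - cZ p z' acirc c))
  - thTD p yv astar acirc

/-- θ_bd. -/
def thBD (p : C → A → Z → Y → ℝ) (yv : Y → ℝ) (astar acirc : A) : ℝ :=
  ∑ c, pC p c * (EYac p yv astar c - EYac p yv acirc c)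

/-- The back-door efficient influence function φ_bd. -/
def phiBD [DecidableEq A] (p : C → A → Z → Y → ℝ) (yv : Y → ℝ) (astar acirc : A)
    (c : C) (a : A) (_z : Z) (y : Y) : ℝ :=
  ind a astar * (yv y - EYac p yv astar c) / cA p astar c
  - ind a acirc * (yv y - EYac p yv acirc c) / cA p acirc c
  + EYac p yv astar c - EYac p yv acirc c - thBD p yv astar acirc

/-- θ° (for the combined back-door/two-door model). -/
def thBDTD (p : C → A → Z → Y → ℝ) (yv : Y → ℝ) (astar acirc : A) : ℝ :=
  ∑ z, ∑ c, EYzc p yv z c * (cZ p z astar c - cZ p z acirc c) * pC p c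

/-- The efficient influence function φ_bdtd. -/
def phiBDTD [DecidableEq A] (p : C → A → Z → Y → ℝ) (yv : Y → ℝ) (astar acirc : A)
    (c : C) (a : A) (z : Z) (y : Y) : ℝ :=
  (yv y - EYzc p yv z c) * (cZ p z astar c - cZ p z acirc c) / (∑ ab, cZ p z ab c * cA p ab c)
  + (EYzc p yv z c - ∑ z', EYzc p yv z' c * cZ p z' a c)
    * (ind a astar - ind a acirc) / cA p a c
  + (∑ z', EYzc p yv z' c * (cZ p z' astar c - cZ p z' acirc c))
  - thBDTD p yv astar acirc

/-- ψ_fd(ă). -/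
def psiFD (p : C → A → Z → Y → ℝ) (yv : Y → ℝ) (abreve : A) : ℝ :=
  ∑ z, ∑ ab, EYaz p yv ab z * pA p ab * cZA p z abreve

/-- θ_fd. -/
def thFD (p : C → A → Z → Y → ℝ) (yv : Y → ℝ) (astar acirc : A) : ℝ :=
  psiFD p yv astar - psiFD p yv acirc

/-- The front-door efficient influence function φ_fd. -/
def phiFD [DecidableEq A] (p : C → A → Z → Y → ℝ) (yv : Y → ℝ) (astar acirc : A)
    (_c : C) (a : A) (z : Z) (y : Y) : ℝ :=
  (yv y - EYaz p yv a z) * (cZA p z astar - cZA p z acirc) / cZA p z a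
  + ind a astar * ((∑ ab, EYaz p yv ab z * pA p ab) - psiFD p yv astar) / pA p astar
  - ind a acirc * ((∑ ab, EYaz p yv ab z * pA p ab) - psiFD p yv acirc) / pA p acirc
  + (∑ z', EYaz p yv a z' * (cZA p z' astar - cZA p z' acirc))
  - thFD p yv astar acirc

/-- θ' (for the combined front-door/two-door model). -/
def thFDTD (p : C → A → Z → Y → ℝ) (yv : Y → ℝ) (astar acirc : A) : ℝ :=
  ∑ c, ∑ ab, ∑ z, EYazc p yv ab z c * (cZA p z astar - cZA p z acirc) * cA p ab c * pC p c

/-- The efficient influence function φ_fdtd. -/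
def phiFDTD [DecidableEq A] (p : C → A → Z → Y → ℝ) (yv : Y → ℝ) (astar acirc : A)
    (c : C) (a : A) (z : Z) (y : Y) : ℝ :=
  (yv y - EYazc p yv a z c) * (cZA p z astar - cZA p z acirc) / cZA p z a
  + (∑ c', ((∑ ab, EYazc p yv ab z c' * cA p ab c')
        - ∑ ab, ∑ z', EYazc p yv ab z' c' * cZA p z' a * cA p ab c') * pC p c')
    * (ind a astar - ind a acirc) / pA p a
  + (∑ z', EYazc p yv a z' c * (cZA p z' astar - cZA p z' acirc))
  - thFDTD p yv astar acirc

/-- θ'' (for the combined back/front/two-door model). -/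
def thBDFDTD (p : C → A → Z → Y → ℝ) (yv : Y → ℝ) (astar acirc : A) : ℝ :=
  ∑ c, ∑ z, EYzc p yv z c * (cZA p z astar - cZA p z acirc) * pC p c

/-- The efficient influence function φ_bdfdtd. -/
def phiBDFDTD [DecidableEq A] (p : C → A → Z → Y → ℝ) (yv : Y → ℝ) (astar acirc : A)
    (c : C) (a : A) (z : Z) (y : Y) : ℝ :=
  (yv y - EYzc p yv z c) * (cZA p z astar - cZA p z acirc) / (∑ ab, cA p ab c * cZA p z ab)
  + (∑ c', (EYzc p yv z c' - ∑ z', EYzc p yv z' c' * cZA p z' a) * pC p c')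
    * (ind a astar - ind a acirc) / (∑ c', pC p c' * cA p a c')
  + (∑ z', EYzc p yv z' c * (cZA p z' astar - cZA p z' acirc))
  - thBDFDTD p yv astar acirc

/-- Second moment about `E - w` of a finite distribution with mean `E`, rescaled by `u`. -/
theorem sum_mul_affine_sq {Y : Type*} [Fintype Y] (k v : Y → ℝ) (E u w : ℝ)
    (hk : ∑ y, k y = 1) (hE : ∑ y, v y * k y = E) :
    ∑ y, k y * (u * (v y - E) + w) ^ 2 =
      u ^ 2 * ((∑ y, v y ^ 2 * k y) - E ^ 2) + w ^ 2 := by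
  have h : ∀ y, k y * (u * (v y - E) + w) ^ 2 =
      u ^ 2 * (v y ^ 2 * k y) + (2 * u * w - 2 * u ^ 2 * E) * (v y * k y)
        + (u * E - w) ^ 2 * k y := fun y => by ring
  simp only [h, sum_add_distrib, ← mul_sum, hk, hE]
  ring

theorem sum_mul_affine {Y : Type*} [Fintype Y] (k v : Y → ℝ) (E u w : ℝ)
    (hk : ∑ y, k y = 1) (hE : ∑ y, v y * k y = E) :
    ∑ y, k y * (u * (v y - E) + w) = w := by
  have h : ∀ y, k y * (u * (v y - E) + w) = u * (v y * k y) + (w - u * E) * k y :=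
    fun y => by ring
  simp only [h, sum_add_distrib, ← mul_sum, hk, hE]
  ring

section Marginals

variable {C A Z Y : Type*} [Fintype C] [Fintype A] [Fintype Z] [Fintype Y]
  {p : C → A → Z → Y → ℝ}

theorem pCAZ_pos [Nonempty Y] (hp : IsPMF p) (c : C) (a : A) (z : Z) : 0 < pCAZ p c a z :=
  sum_pos (fun y _ => hp.1 c a z y) univ_nonempty

theorem pAC_pos [Nonempty Z] [Nonempty Y] (hp : IsPMF p) (a : A) (c : C) : 0 < pAC p a c :=
  sum_pos (fun z _ => pCAZ_pos hp c a z) univ_nonempty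

theorem pA_pos [Nonempty C] [Nonempty Z] [Nonempty Y] (hp : IsPMF p) (a : A) : 0 < pA p a :=
  sum_pos (fun c _ => pAC_pos hp a c) univ_nonempty

theorem pC_pos [Nonempty A] [Nonempty Z] [Nonempty Y] (hp : IsPMF p) (c : C) : 0 < pC p c :=
  sum_pos (fun a _ => pAC_pos hp a c) univ_nonempty

theorem pZC_pos [Nonempty A] [Nonempty Y] (hp : IsPMF p) (z : Z) (c : C) : 0 < pZC p z c :=
  sum_pos (fun a _ => pCAZ_pos hp c a z) univ_nonempty

theorem sum_pC (hp : IsPMF p) : ∑ c, pC p c = 1 := hp.2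

theorem sum_cZA [Nonempty C] [Nonempty Z] [Nonempty Y] (hp : IsPMF p) (a : A) :
    ∑ z, cZA p z a = 1 := by
  simp only [cZA, ← sum_div]
  rw [div_eq_one_iff_eq (pA_pos hp a).ne']
  simp only [pAZ, pA, pAC, pCAZ]
  exact sum_comm

theorem sum_cYzc [Nonempty A] [Nonempty Y] (hp : IsPMF p) (z : Z) (c : C) :
    ∑ y, cYzc p z c y = 1 := by
  simp only [cYzc, ← sum_div]
  rw [div_eq_one_iff_eq (pZC_pos hp z c).ne']
  simp only [pZC, pCAZ]
  exact sum_comm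

theorem pCAZ_eq_mul [Nonempty Z] [Nonempty Y] (hp : IsPMF p) (hzc : IndepZC p)
    (c : C) (a : A) (z : Z) : pCAZ p c a z = pAC p a c * cZA p z a := by
  rw [← hzc z a c, cZ, mul_div_cancel₀ _ (pAC_pos hp a c).ne']

theorem cYzc_eq_cY [Nonempty A] [Nonempty Y] (hp : IsPMF p) (hind : IndepYA p)
    (a : A) (z : Z) (c : C) (y : Y) : cYzc p z c y = cY p a z c y := by
  rw [cYzc, div_eq_iff (pZC_pos hp z c).ne', pZC, mul_sum]
  refine sum_congr rfl fun a' _ => ?_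
  rw [hind a a' z c y, cY, div_mul_cancel₀ _ (pCAZ_pos hp c a' z).ne']

/-- Factorization of the joint mass function under both conditional independences. -/
theorem eq_pAC_mul_cZA_mul_cYzc [Nonempty A] [Nonempty Z] [Nonempty Y] (hp : IsPMF p)
    (hzc : IndepZC p) (hind : IndepYA p) (c : C) (a : A) (z : Z) (y : Y) :
    p c a z y = pAC p a c * (cZA p z a * cYzc p z c y) := by
  rw [← mul_assoc, ← pCAZ_eq_mul hp hzc, cYzc_eq_cY hp hind a, cY,
    mul_div_cancel₀ _ (pCAZ_pos hp c a z).ne']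

theorem sum_pC_mul_cA [Nonempty A] [Nonempty Z] [Nonempty Y] (hp : IsPMF p) (a : A) :
    ∑ c, pC p c * cA p a c = pA p a :=
  sum_congr rfl fun c _ => by rw [cA, mul_div_cancel₀ _ (pC_pos hp c).ne']

theorem sum_pAC_mul_cZA [Nonempty A] [Nonempty Z] [Nonempty Y] (hp : IsPMF p) (z : Z) (c : C) :
    ∑ a, pAC p a c * cZA p z a = pC p c * ∑ a, cA p a c * cZA p z a := by
  rw [mul_sum]
  refine sum_congr rfl fun a _ => ?_
  rw [cA, ← mul_assoc, mul_div_cancel₀ _ (pC_pos hp c).ne']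

theorem sum_cA_mul_cZA_pos [Nonempty C] [Nonempty A] [Nonempty Z] [Nonempty Y] (hp : IsPMF p)
    (z : Z) (c : C) : 0 < ∑ a, cA p a c * cZA p z a :=
  sum_pos (fun a _ => mul_pos (div_pos (pAC_pos hp a c) (pC_pos hp c))
    (div_pos (sum_pos (fun c _ => pCAZ_pos hp c a z) univ_nonempty) (pA_pos hp a)))
    univ_nonempty

/-- The variance of a sum of residuals of `Y` given `(Z, C)`, of `Z` given `A`, and of a centered
function of `C` is the sum of the variances. -/
theorem Varp_residual_decomposition [Nonempty C] [Nonempty A] [Nonempty Z] [Nonempty Y]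
    (hp : IsPMF p) (hzc : IndepZC p) (hind : IndepYA p) (yv : Y → ℝ)
    (U : Z → C → ℝ) (T : A → Z → ℝ) (S : C → ℝ)
    (hT : ∀ a, ∑ z, cZA p z a * T a z = 0) (hS : ∑ c, pC p c * S c = 0) :
    Varp p (fun c a z y => U z c * (yv y - EYzc p yv z c) + (T a z + S c)) =
      (∑ z, ∑ c, pC p c * (∑ a, cA p a c * cZA p z a) * (U z c ^ 2 * VYzc p yv z c))
      + (∑ a, pA p a * ∑ z, cZA p z a * T a z ^ 2) + ∑ c, pC p c * S c ^ 2 := by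
  have hmean : Ep p (fun c a z y => U z c * (yv y - EYzc p yv z c) + (T a z + S c)) = 0 := by
    simp only [Ep, eq_pAC_mul_cZA_mul_cYzc hp hzc hind, mul_assoc]
    simp only [← mul_sum, sum_mul_affine _ _ _ _ _ (sum_cYzc hp _ _) rfl, EYzc]
    simp only [mul_add, sum_add_distrib, hT, ← sum_mul, sum_cZA hp]
    simpa [← sum_mul, pC, pAC] using hS
  have hinner : ∀ c a, (∑ z, cZA p z a * (U z c ^ 2 * VYzc p yv z c + (T a z + S c) ^ 2)) =
      (∑ z, cZA p z a * (U z c ^ 2 * VYzc p yv z c)) + (∑ z, cZA p z a * T a z ^ 2)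
        + S c ^ 2 := by
    intro c a
    have h : ∀ z, cZA p z a * (U z c ^ 2 * VYzc p yv z c + (T a z + S c) ^ 2) =
        cZA p z a * (U z c ^ 2 * VYzc p yv z c) + cZA p z a * T a z ^ 2
          + 2 * S c * (cZA p z a * T a z) + S c ^ 2 * cZA p z a := fun z => by ring
    simp only [h, sum_add_distrib, ← mul_sum, hT, sum_cZA hp]
    ring
  have hY : ∀ c a z, (∑ y, p c a z y *
      (U z c * (yv y - EYzc p yv z c) + (T a z + S c)) ^ 2) =
      pAC p a c * (cZA p z a * (U z c ^ 2 * VYzc p yv z c + (T a z + S c) ^ 2)) := by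
    intro c a z
    simp only [eq_pAC_mul_cZA_mul_cYzc hp hzc hind, mul_assoc, ← mul_sum]
    rw [sum_mul_affine_sq _ _ (EYzc p yv z c) _ _ (sum_cYzc hp z c) rfl, VYzc]
  rw [Varp, hmean]
  simp only [hY, ← mul_sum, hinner]
  simp only [mul_add, sum_add_distrib]
  have hA : (∑ c, ∑ a, pAC p a c * ∑ z, cZA p z a * (U z c ^ 2 * VYzc p yv z c)) =
      ∑ z, ∑ c, pC p c * (∑ a, cA p a c * cZA p z a) * (U z c ^ 2 * VYzc p yv z c) := by
    rw [sum_comm (s := (univ : Finset Z))]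
    refine sum_congr rfl fun c _ => ?_
    simp only [mul_sum, ← sum_pAC_mul_cZA hp, sum_mul]
    rw [sum_comm]
    simp only [mul_assoc]
  have hB : (∑ c, ∑ a, pAC p a c * ∑ z, cZA p z a * T a z ^ 2) =
      ∑ a, pA p a * ∑ z, cZA p z a * T a z ^ 2 := by
    rw [sum_comm]
    simp only [← sum_mul, pA]
  have hC : (∑ c, ∑ a, pAC p a c * S c ^ 2) = ∑ c, pC p c * S c ^ 2 := by
    simp only [← sum_mul]; rfl
  rw [hA, hB, hC]
  ring

end Marginals

/-- Proposition 8 (efficiency bound under the combined back/front/two-door model). -/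
theorem stmt15
    {C A Z Y : Type*} [Fintype C] [Fintype A] [Fintype Z] [Fintype Y]
    [Nonempty C] [Nonempty A] [Nonempty Z] [Nonempty Y] [DecidableEq A]
    (p : C → A → Z → Y → ℝ) (yv : Y → ℝ) (hyv : Function.Injective yv)
    (hp : IsPMF p) (astar acirc : A) (hne : astar ≠ acirc)
    (hzc : IndepZC p) (hind : IndepYA p) :
    Varp p (phiBDFDTD p yv astar acirc) =
      (∑ z, (cZA p z astar - cZA p z acirc) ^ 2
          * ∑ c, pC p c * VYzc p yv z c / (∑ ab, cA p ab c * cZA p z ab))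
      + (∑ z, cZA p z astar * (∑ c, pC p c * EYzc p yv z c) ^ 2) / pA p astar
      - (∑ z, ∑ c, EYzc p yv z c * cZA p z astar * pC p c) ^ 2 / pA p astar
      + (∑ z, cZA p z acirc * (∑ c, pC p c * EYzc p yv z c) ^ 2) / pA p acirc
      - (∑ z, ∑ c, EYzc p yv z c * cZA p z acirc * pC p c) ^ 2 / pA p acirc
      + (∑ c, pC p c * (∑ z, EYzc p yv z c * (cZA p z astar - cZA p z acirc)) ^ 2)
      - (thBDFDTD p yv astar acirc) ^ 2 := by
  obtain ⟨g, hg⟩ : ∃ g : Z → ℝ, ∀ z, g z = ∑ c, pC p c * EYzc p yv z c := ⟨_, fun _ => rfl⟩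
  obtain ⟨m, hm⟩ : ∃ m : A → ℝ, ∀ a, m a = ∑ z, cZA p z a * g z := ⟨_, fun _ => rfl⟩
  obtain ⟨h, hh⟩ : ∃ h : C → ℝ,
      ∀ c, h c = ∑ z, EYzc p yv z c * (cZA p z astar - cZA p z acirc) := ⟨_, fun _ => rfl⟩
  have hmexp : ∀ a, (∑ z, ∑ c, EYzc p yv z c * cZA p z a * pC p c) = m a := by
    intro a
    simp only [hm, hg, mul_sum]
    exact sum_congr rfl fun z _ => sum_congr rfl fun c _ => by ring
  have hθ : ∑ c, pC p c * h c = thBDFDTD p yv astar acirc := by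
    simp only [hh, thBDFDTD, mul_sum]
    exact sum_congr rfl fun c _ => sum_congr rfl fun z _ => by ring
  have hcenter : ∀ a z,
      (∑ c, (EYzc p yv z c - ∑ z', EYzc p yv z' c * cZA p z' a) * pC p c) = g z - m a := by
    intro a z
    rw [← hmexp a, sum_comm, hg]
    simp only [sub_mul, sum_sub_distrib, sum_mul]
    congr 1
    exact sum_congr rfl fun c _ => mul_comm _ _
  have hphi : phiBDFDTD p yv astar acirc = fun c a z y =>
      (cZA p z astar - cZA p z acirc) / (∑ ab, cA p ab c * cZA p z ab)
          * (yv y - EYzc p yv z c)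
        + ((g z - m a) * ((ind a astar - ind a acirc) / pA p a)
          + (h c - thBDFDTD p yv astar acirc)) := by
    funext c a z y
    rw [phiBDFDTD, hcenter, sum_pC_mul_cA hp, hh]
    ring
  have hvar : ∀ a, ∑ z, cZA p z a * (g z - m a) ^ 2 = (∑ z, cZA p z a * g z ^ 2) - m a ^ 2 := by
    intro a
    have := sum_mul_affine_sq (fun z => cZA p z a) g (m a) 1 0 (sum_cZA hp a)
      (by rw [hm]; exact sum_congr rfl fun z _ => mul_comm _ _)
    simpa [mul_comm] using this
  rw [hphi, Varp_residual_decomposition hp hzc hind yv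
    (fun z c => (cZA p z astar - cZA p z acirc) / (∑ ab, cA p ab c * cZA p z ab))
    (fun a z => (g z - m a) * ((ind a astar - ind a acirc) / pA p a))
    (fun c => h c - thBDFDTD p yv astar acirc)]
  · have hY : (∑ z, ∑ c, pC p c * (∑ a, cA p a c * cZA p z a) *
        (((cZA p z astar - cZA p z acirc) / (∑ ab, cA p ab c * cZA p z ab)) ^ 2
          * VYzc p yv z c)) =
        ∑ z, (cZA p z astar - cZA p z acirc) ^ 2
          * ∑ c, pC p c * VYzc p yv z c / (∑ ab, cA p ab c * cZA p z ab) := by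
      refine sum_congr rfl fun z _ => ?_
      rw [mul_sum]
      refine sum_congr rfl fun c _ => ?_
      have := (sum_cA_mul_cZA_pos hp z c).ne'
      field_simp
    have hZ : (∑ a, pA p a * ∑ z, cZA p z a *
        ((g z - m a) * ((ind a astar - ind a acirc) / pA p a)) ^ 2) =
        ((∑ z, cZA p z astar * g z ^ 2) - m astar ^ 2) / pA p astar
          + ((∑ z, cZA p z acirc * g z ^ 2) - m acirc ^ 2) / pA p acirc := by
      have hterm : ∀ a, pA p a * (∑ z, cZA p z a *
          ((g z - m a) * ((ind a astar - ind a acirc) / pA p a)) ^ 2) =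
          (if a = astar then ((∑ z, cZA p z a * g z ^ 2) - m a ^ 2) / pA p a else 0)
            + (if a = acirc then ((∑ z, cZA p z a * g z ^ 2) - m a ^ 2) / pA p a else 0) := by
        intro a
        have hpa := (pA_pos hp a).ne'
        simp only [mul_pow, ← mul_assoc, ← sum_mul, hvar]
        simp only [ind]
        split_ifs with h₁ h₂ h₂
        · exact absurd (h₁.symm.trans h₂) hne
        all_goals field_simp
        all_goals ring
      simp only [hterm, sum_add_distrib, sum_ite_eq', mem_univ, if_true]
    have hC : (∑ c, pC p c * (h c - thBDFDTD p yv astar acirc) ^ 2) =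
        (∑ c, pC p c * h c ^ 2) - thBDFDTD p yv astar acirc ^ 2 := by
      have := sum_mul_affine_sq (pC p) h (thBDFDTD p yv astar acirc) 1 0 (sum_pC hp)
        (by rw [← hθ]; exact sum_congr rfl fun c _ => mul_comm _ _)
      simpa [mul_comm] using this
    rw [hY, hZ, hC, hmexp, hmexp]
    simp only [← hg, ← hh]
    ring
  · intro a
    have := sum_mul_affine (fun z => cZA p z a) g (m a) ((ind a astar - ind a acirc) / pA p a) 0
      (sum_cZA hp a) (by rw [hm]; exact sum_congr rfl fun z _ => mul_comm _ _)
    simpa [mul_comm] using this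
  · simp [mul_sub, sum_sub_distrib, hθ, ← sum_mul, sum_pC hp]

end TwoDoorPaper
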